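/- Under hypotheses (H2) and (H4), for every vector v ∈ ℝ^d one has inf_{T>0} T·(log φ)*(v/T) = sup_{a∈D} a·v, where (log φ)*(u) := sup_{a∈ℝ^d} (a·u − log φ(a)) is the convex conjugate of log φ. In particular, the quasi-potential I⁺(q',q) of the rate function of the scaled killed random walks equals sup_{a∈D} a·(q−q') for all q', q ∈ ℝ^{d−1}×[0,∞). -/

import Mathlib

open scoped ENNReal
open Filter MeasureTheory

namespace ReflectedRW

/-- `ℤ^d` realized as `ℤ^{d-1} × ℤ`. -/
abbrev Zd (d : ℕ) := (Fin (d-1) → ℤ) × ℤ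
/-- `ℝ^d` realized as `ℝ^{d-1} × ℝ`. -/
abbrev Rd (d : ℕ) := (Fin (d-1) → ℝ) × ℝ
/-- The state space `ℤ^{d-1} × ℕ` of the reflected walk. -/
abbrev St (d : ℕ) := (Fin (d-1) → ℤ) × ℕ

/-- Embedding of the state space into `ℤ^d`. -/
def toZ (d : ℕ) (z : St d) : Zd d := (z.1, (z.2 : ℤ))

/-- Embedding of `ℤ^d` into `ℝ^d`. -/
def toR (d : ℕ) (z : Zd d) : Rd d := (fun i => (z.1 i : ℝ), (z.2 : ℝ))

/-- Scalar product `a · z` of `a ∈ ℝ^d` and `z ∈ ℤ^d`. -/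
noncomputable def dotZ (d : ℕ) (a : Rd d) (z : Zd d) : ℝ :=
  (∑ i, a.1 i * (z.1 i : ℝ)) + a.2 * (z.2 : ℝ)

/-- Scalar product on `ℝ^d`. -/
noncomputable def dotR (d : ℕ) (a q : Rd d) : ℝ :=
  (∑ i, a.1 i * q.1 i) + a.2 * q.2

/-- One-step transition probabilities of the reflected random walk `Z(t)`:
jumps with law `μ` in the interior and with law `μ0` on the boundary `y = 0`. -/
noncomputable def step (d : ℕ) (μ μ0 : Zd d → ℝ) (z z' : St d) : ℝ≥0∞ :=
  if z.2 = 0 then ENNReal.ofReal (μ0 (toZ d z' - toZ d z))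
  else ENNReal.ofReal (μ (toZ d z' - toZ d z))

/-- Real-valued version of the transition kernel of `Z(t)`. -/
noncomputable def stepR (d : ℕ) (μ μ0 : Zd d → ℝ) (z z' : St d) : ℝ :=
  if z.2 = 0 then μ0 (toZ d z' - toZ d z) else μ (toZ d z' - toZ d z)

/-- `n`-step kernel obtained by iterating a sub-Markov kernel `p`. -/
noncomputable def kerIter {S : Type*} [DecidableEq S] (p : S → S → ℝ≥0∞) :
    ℕ → S → S → ℝ≥0∞
  | 0, z, z' => if z = z' then 1 else 0
  | n+1, z, z' => ∑' w : S, kerIter p n z w * p w z'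

/-- `n`-step transition probabilities of `Z(t)`: `P_z(Z(n) = z')`. -/
noncomputable def stepn (d : ℕ) (μ μ0 : Zd d → ℝ) : ℕ → St d → St d → ℝ≥0∞ :=
  kerIter (step d μ μ0)

/-- Green's function `G(z,z') = ∑_{t ≥ 0} P_z(Z(t) = z')` of the reflected walk. -/
noncomputable def green (d : ℕ) (μ μ0 : Zd d → ℝ) (z z' : St d) : ℝ≥0∞ :=
  ∑' n : ℕ, stepn d μ μ0 n z z'

/-- Kernel of the walk killed upon hitting the boundary hyperplane `y = 0`. -/
noncomputable def stepKilled (d : ℕ) (μ μ0 : Zd d → ℝ) (z z' : St d) : ℝ≥0∞ :=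
  if z'.2 = 0 then 0 else step d μ μ0 z z'

/-- `n`-step kernel of the killed walk: `P_z(Z(n) = z', τ > n)` where
`τ` is the first return time to the boundary hyperplane. -/
noncomputable def stepKilledn (d : ℕ) (μ μ0 : Zd d → ℝ) : ℕ → St d → St d → ℝ≥0∞ :=
  kerIter (stepKilled d μ μ0)

/-- Green's function `G₊(z,z')` of the killed walk. -/
noncomputable def greenPlus (d : ℕ) (μ μ0 : Zd d → ℝ) (z z' : St d) : ℝ≥0∞ :=
  ∑' n : ℕ, stepKilledn d μ μ0 n z z'

/-- One-step kernel of the homogeneous random walk `S(t)` on `ℤ^d`. -/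
noncomputable def stepS (d : ℕ) (μ : Zd d → ℝ) (z z' : Zd d) : ℝ≥0∞ :=
  ENNReal.ofReal (μ (z' - z))

/-- `n`-step kernel of the homogeneous random walk on `ℤ^d`. -/
noncomputable def stepSn (d : ℕ) (μ : Zd d → ℝ) : ℕ → Zd d → Zd d → ℝ≥0∞ :=
  kerIter (stepS d μ)

/-- Green's function `G_S` of the homogeneous random walk on `ℤ^d`. -/
noncomputable def greenS (d : ℕ) (μ : Zd d → ℝ) (z z' : Zd d) : ℝ≥0∞ :=
  ∑' n : ℕ, stepSn d μ n z z'

/-- `hitProb z w = P_z(τ < ∞, Z(τ) = w)`, the hitting distribution on the boundary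
hyperplane, `τ = inf{t ≥ 1 : Z(t) ∈ ℤ^{d-1}×{0}}`. -/
noncomputable def hitProb (d : ℕ) (μ μ0 : Zd d → ℝ) (z w : St d) : ℝ≥0∞ :=
  if w.2 = 0 then
    ∑' n : ℕ, ∑' v : St d, stepKilledn d μ μ0 n z v * step d μ μ0 v w
  else 0

/-- The jump generating function `φ(a) = ∑_z μ(z) e^{a·z}`. -/
noncomputable def jgf (d : ℕ) (μ : Zd d → ℝ) (a : Rd d) : ℝ :=
  ∑' z : Zd d, μ z * Real.exp (dotZ d a z)

/-- Partial derivative `∂φ/∂β` of the jump generating function in the last coordinate. -/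
noncomputable def jgfDβ (d : ℕ) (μ : Zd d → ℝ) (a : Rd d) : ℝ :=
  ∑' z : Zd d, μ z * (z.2 : ℝ) * Real.exp (dotZ d a z)

/-- Gradient `∇φ(a)` of the jump generating function. -/
noncomputable def jgfGrad (d : ℕ) (μ : Zd d → ℝ) (a : Rd d) : Rd d :=
  (fun i => ∑' z : Zd d, μ z * (z.1 i : ℝ) * Real.exp (dotZ d a z), jgfDβ d μ a)

/-- The set `D = {a : φ(a) ≤ 1}`. -/
def Dset (d : ℕ) (μ : Zd d → ℝ) : Set (Rd d) := {a | jgf d μ a ≤ 1}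

/-- `∂₊D`: points of the boundary of `D` where the last coordinate of `∇φ` is `≥ 0`. -/
def bdPlus (d : ℕ) (μ : Zd d → ℝ) : Set (Rd d) :=
  {a | jgf d μ a = 1 ∧ 0 ≤ jgfDβ d μ a}

/-- `∂₋D`: points of the boundary of `D` where the last coordinate of `∇φ` is `≤ 0`. -/
def bdMinus (d : ℕ) (μ : Zd d → ℝ) : Set (Rd d) :=
  {a | jgf d μ a = 1 ∧ jgfDβ d μ a ≤ 0}

/-- `∂₀D`: points of the boundary of `D` where the last coordinate of `∇φ` is `0`. -/
def bdZero (d : ℕ) (μ : Zd d → ℝ) : Set (Rd d) :=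
  {a | jgf d μ a = 1 ∧ jgfDβ d μ a = 0}

/-- `Θ = {α ∈ ℝ^{d-1} : inf_β max(φ(α,β), φ₀(α,β)) ≤ 1}`. -/
noncomputable def Theta (d : ℕ) (μ μ0 : Zd d → ℝ) : Set (Fin (d-1) → ℝ) :=
  {α | (⨅ β : ℝ, max (jgf d μ (α, β)) (jgf d μ0 (α, β))) ≤ 1}

/-- `D̂ = (Θ×ℝ) ∩ D`. -/
noncomputable def Dhat (d : ℕ) (μ μ0 : Zd d → ℝ) : Set (Rd d) :=
  {a | a.1 ∈ Theta d μ μ0 ∧ jgf d μ a ≤ 1}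

/-- Normal cone to a convex set `s ⊆ ℝ^d` at the point `a`. -/
noncomputable def normalCone (d : ℕ) (s : Set (Rd d)) (a : Rd d) : Set (Rd d) :=
  {q | ∀ b ∈ s, dotR d q (b - a) ≤ 0}

/-- The mean vector `m = ∑_z z μ(z)`. -/
noncomputable def meanVec (d : ℕ) (μ : Zd d → ℝ) : Rd d :=
  (fun i => ∑' z : Zd d, μ z * (z.1 i : ℝ), ∑' z : Zd d, μ z * (z.2 : ℝ))

/-- The harmonic functions `h_a` of (1-8), for `a ∈ D̂ ∩ ∂₊D` with associated
point `abar = ā ∈ ∂₋D` (same first `d-1` coordinates as `a`). -/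
noncomputable def hfun (d : ℕ) (μ μ0 : Zd d → ℝ) (a abar : Rd d) (z : St d) : ℝ :=
  if jgf d μ0 abar = 1 then Real.exp (dotZ d abar (toZ d z))
  else if a = abar then
    (z.2 : ℝ) * Real.exp (dotZ d a (toZ d z))
      + (jgfDβ d μ0 a / (1 - jgf d μ0 a)) * Real.exp (dotZ d a (toZ d z))
  else
    Real.exp (dotZ d a (toZ d z))
      - ((1 - jgf d μ0 a) / (1 - jgf d μ0 abar)) * Real.exp (dotZ d abar (toZ d z))

/-- `h : ℤ^{d-1}×ℕ → ℝ` is harmonic for the reflected walk. -/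
def IsHarmonic (d : ℕ) (μ μ0 : Zd d → ℝ) (h : St d → ℝ) : Prop :=
  ∀ z : St d, HasSum (fun z' => stepR d μ μ0 z z' * h z') (h z)

/-- Minimal nonnegative harmonic function. -/
def IsMinimalHarmonic (d : ℕ) (μ μ0 : Zd d → ℝ) (h : St d → ℝ) : Prop :=
  IsHarmonic d μ μ0 h ∧ (∀ z, 0 ≤ h z) ∧ h ≠ 0 ∧
    ∀ h' : St d → ℝ, IsHarmonic d μ μ0 h' → (∀ z, 0 ≤ h' z) → h' ≠ 0 →
      (∀ z, h' z ≤ h z) → ∃ c : ℝ, 0 < c ∧ h' = fun z => c * h z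

/- Hypotheses (H0)–(H4). -/

/-- `(H0)`: `μ(x,y) = 0` for `y < -1` and `μ₀(x,y) = 0` for `y < 0`. -/
def H0 (d : ℕ) (μ μ0 : Zd d → ℝ) : Prop :=
  (∀ z : Zd d, z.2 < -1 → μ z = 0) ∧ (∀ z : Zd d, z.2 < 0 → μ0 z = 0)

/-- `(H1)`: the reflected walk is irreducible on `ℤ^{d-1}×ℕ`. -/
def H1 (d : ℕ) (μ μ0 : Zd d → ℝ) : Prop :=
  ∀ z z' : St d, ∃ n : ℕ, 0 < stepn d μ μ0 n z z'

/-- `(H2)`: the homogeneous walk with step law `μ` is irreducible on `ℤ^d` and its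
last coordinate is an aperiodic random walk on `ℤ`. -/
def H2 (d : ℕ) (μ : Zd d → ℝ) : Prop :=
  (∀ z z' : Zd d, ∃ n : ℕ, 0 < stepSn d μ n z z') ∧
    AddSubgroup.closure {y : ℤ | ∃ x : Fin (d-1) → ℤ, μ (x, y) ≠ 0} = ⊤

/-- `(H3)`: `m ≠ 0` and `m/|m| + m₀/|m₀| ≠ 0`. -/
noncomputable def H3 (d : ℕ) (μ μ0 : Zd d → ℝ) : Prop :=
  meanVec d μ ≠ 0 ∧ meanVec d μ0 ≠ 0 ∧
    ‖meanVec d μ‖⁻¹ • meanVec d μ + ‖meanVec d μ0‖⁻¹ • meanVec d μ0 ≠ 0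

/-- `(H4)`: the jump generating functions are finite everywhere on `ℝ^d`. -/
def H4 (d : ℕ) (μ μ0 : Zd d → ℝ) : Prop :=
  ∀ a : Rd d, Summable (fun z : Zd d => μ z * Real.exp (dotZ d a z)) ∧
    Summable (fun z : Zd d => μ0 z * Real.exp (dotZ d a z))

/-- `μ` is a probability distribution on `ℤ^d`. -/
def IsProb (d : ℕ) (μ : Zd d → ℝ) : Prop :=
  (∀ z : Zd d, 0 ≤ μ z) ∧ HasSum μ 1


/-- The convex conjugate `(log φ)*` of `log φ`, with values in `EReal`. -/
noncomputable def logConj (d : ℕ) (μ : Zd d → ℝ) (u : Rd d) : EReal :=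
  ⨆ a : Rd d, ((dotR d a u - Real.log (jgf d μ a) : ℝ) : EReal)

/-- Lagrange multiplier rule for maximizing a linear form over the sublevel set `{f ≤ 0}` of a
convex function with bounded sublevel sets: any strict upper bound of the linear form on `{f ≤ 0}`
bounds a Lagrangian with positive multiplier. No Slater condition is needed. -/
theorem exists_pos_multiplier {E : Type*} [NormedAddCommGroup E] [NormedSpace ℝ E]
    [FiniteDimensional ℝ E] {f : E → ℝ} (hf : ConvexOn ℝ Set.univ f) {x₀ : E} (h0 : f x₀ ≤ 0)
    (hbdd : Bornology.IsBounded {x | f x ≤ 1}) {M : ℝ} (hM : ∀ x, -M ≤ f x)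
    (l : E →ₗ[ℝ] ℝ) {c : ℝ} (hc : ∀ x, f x ≤ 0 → l x < c) :
    ∃ T : ℝ, 0 < T ∧ ∀ x, l x - T * f x ≤ c := by
  have hfc : Continuous f := by
    rw [← continuousOn_univ]
    exact hf.continuousOn isOpen_univ
  have hlc : Continuous l := l.continuous_of_finiteDimensional
  have hcomp : IsCompact {x | f x ≤ 1} :=
    Metric.isCompact_of_isClosed_isBounded (isClosed_le hfc continuous_const) hbdd
  obtain ⟨ε, hε, hε1, hεc⟩ : ∃ ε : ℝ, 0 < ε ∧ ε ≤ 1 ∧ ∀ x, f x ≤ ε → l x < c := by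
    have hK : IsCompact ({x | f x ≤ 1} ∩ {x | c ≤ l x}) :=
      hcomp.inter_right (isClosed_le continuous_const hlc)
    rcases Set.eq_empty_or_nonempty ({x | f x ≤ 1} ∩ {x | c ≤ l x}) with he | hne
    · refine ⟨1, one_pos, le_rfl, fun x hx => ?_⟩
      by_contra! h
      exact (Set.eq_empty_iff_forall_notMem.1 he x) ⟨hx, h⟩
    · obtain ⟨y, hy, hmin⟩ := hK.exists_isMinOn hne hfc.continuousOn
      have hy0 : 0 < f y := by
        by_contra! h
        exact absurd (hc y h) (not_lt.2 hy.2)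
      refine ⟨f y / 2, by positivity, ?_, fun x hx => ?_⟩
      · have : f y ≤ 1 := hy.1
        linarith
      · by_contra! h
        have h1 : f y ≤ 1 := hy.1
        have := hmin (show x ∈ {x | f x ≤ 1} ∩ {x | c ≤ l x} from
          ⟨show f x ≤ 1 by linarith, h⟩)
        simp only [Set.mem_ofPred_eq] at this
        linarith
  have hcompε : IsCompact {x | f x ≤ ε} :=
    hcomp.of_isClosed_subset (isClosed_le hfc continuous_const)
      fun x (hx : f x ≤ ε) => hx.trans hε1
  obtain ⟨y, hy, hmax⟩ := hcompε.exists_isMaxOn ⟨x₀, h0.trans hε.le⟩ hlc.continuousOn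
  have hyc : l y < c := hεc y hy
  have hmax' : ∀ x, f x ≤ ε → l x ≤ l y := fun x hx => hmax hx
  let S : Set ℝ := {r | ∃ b, f b < ε ∧ r = (c - l b) / (ε - f b)}
  have hSne : S.Nonempty := ⟨_, x₀, h0.trans_lt hε, rfl⟩
  have hMε : 0 < ε + M := by
    have := hM x₀
    linarith
  have hlow : ∀ r ∈ S, (c - l y) / (ε + M) ≤ r := by
    rintro r ⟨b, hb, rfl⟩
    have h1 := hmax' b hb.le
    have h2 := hM b
    exact div_le_div₀ (by linarith) (by linarith) (by linarith) (by linarith)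
  have hbelow : BddBelow S := ⟨_, hlow⟩
  have hTpos : 0 < sInf S :=
    (div_pos (sub_pos.2 hyc) hMε).trans_le (le_csInf hSne hlow)
  have key : ∀ x, l x - sInf S * (f x - ε) ≤ c := by
    intro x
    rcases lt_trichotomy (f x) ε with hx | hx | hx
    · have := csInf_le hbelow (show (c - l x) / (ε - f x) ∈ S from ⟨x, hx, rfl⟩)
      rw [le_div_iff₀ (by linarith)] at this
      linarith
    · have := hεc x hx.le
      rw [hx]
      simpa using this.le
    · have h : (l x - c) / (f x - ε) ≤ sInf S := by
        refine le_csInf hSne ?_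
        rintro r ⟨b, hb, rfl⟩
        have hp : 0 < ε - f b := by linarith
        have hq : 0 < f x - ε := by linarith
        have hs : 0 < f x - f b := by linarith
        have hconv := hf.2 (Set.mem_univ x) (Set.mem_univ b)
          (div_nonneg hp.le hs.le) (div_nonneg hq.le hs.le)
          (by rw [← add_div, div_eq_one_iff_eq hs.ne']; ring)
        have hle : f (((ε - f b) / (f x - f b)) • x + ((f x - ε) / (f x - f b)) • b) ≤ ε := by
          refine hconv.trans (le_of_eq ?_)
          simp only [smul_eq_mul]
          field_simp
          ring
        have hl := (hεc _ hle).le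
        simp only [map_add, map_smul, smul_eq_mul] at hl
        rw [div_mul_eq_mul_div, div_mul_eq_mul_div, ← add_div, div_le_iff₀ hs] at hl
        rw [div_le_div_iff₀ hq hp]
        nlinarith
      rw [div_le_iff₀ (by linarith)] at h
      linarith
  refine ⟨sInf S, hTpos, fun x => ?_⟩
  have := key x
  nlinarith [mul_pos hTpos hε]

theorem dotZ_combo (d : ℕ) (s t : ℝ) (a b : Rd d) (z : Zd d) :
    dotZ d (s • a + t • b) z = s * dotZ d a z + t * dotZ d b z := by
  simp only [dotZ, Prod.fst_add, Prod.smul_fst, Prod.snd_add, Prod.smul_snd, Pi.add_apply,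
    Pi.smul_apply, smul_eq_mul, mul_add, Finset.mul_sum, add_mul, Finset.sum_add_distrib]
  simp only [mul_assoc]
  ring

theorem dotZ_add_right (d : ℕ) (a : Rd d) (z w : Zd d) :
    dotZ d a (z + w) = dotZ d a z + dotZ d a w := by
  simp only [dotZ, Prod.fst_add, Prod.snd_add, Pi.add_apply, Int.cast_add, mul_add,
    Finset.sum_add_distrib]
  ring

theorem dotZ_neg_right (d : ℕ) (a : Rd d) (z : Zd d) : dotZ d a (-z) = -dotZ d a z := by
  simp only [dotZ, Prod.fst_neg, Prod.snd_neg, Pi.neg_apply, Int.cast_neg, mul_neg,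
    Finset.sum_neg_distrib]
  ring

/-- The linear form `a ↦ a · v`. -/
noncomputable def dotRLin (d : ℕ) (v : Rd d) : Rd d →ₗ[ℝ] ℝ where
  toFun a := dotR d a v
  map_add' a b := by
    simp only [dotR, Prod.fst_add, Prod.snd_add, Pi.add_apply, add_mul, Finset.sum_add_distrib]
    ring
  map_smul' t a := by
    simp only [dotR, Prod.smul_fst, Prod.smul_snd, Pi.smul_apply, smul_eq_mul, mul_add,
      Finset.mul_sum, mul_assoc, RingHom.id_apply]

theorem dotR_smul_right (d : ℕ) (t : ℝ) (a v : Rd d) : dotR d a (t • v) = t * dotR d a v := by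
  simp only [dotR, Prod.smul_fst, Prod.smul_snd, Pi.smul_apply, smul_eq_mul, mul_add,
    Finset.mul_sum, mul_left_comm]

theorem jgf_pos (d : ℕ) {μ : Zd d → ℝ} (hμ : IsProb d μ)
    (hs : ∀ a : Rd d, Summable fun z : Zd d => μ z * Real.exp (dotZ d a z)) (a : Rd d) :
    0 < jgf d μ a := by
  obtain ⟨z, hz⟩ : ∃ z, 0 < μ z := by
    by_contra! h
    have h0 : μ = 0 := funext fun z => le_antisymm (h z) (hμ.1 z)
    have h1 := hμ.2
    rw [h0] at h1
    exact zero_ne_one (hasSum_zero.unique h1)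
  exact (hs a).tsum_pos (fun w => mul_nonneg (hμ.1 w) (Real.exp_pos _).le) z
    (mul_pos hz (Real.exp_pos _))

theorem jgf_zero (d : ℕ) {μ : Zd d → ℝ} (hμ : IsProb d μ) : jgf d μ 0 = 1 := by
  simpa [jgf, dotZ] using hμ.2.tsum_eq

theorem convexOn_log_jgf (d : ℕ) {μ : Zd d → ℝ} (hμ : IsProb d μ)
    (hs : ∀ a : Rd d, Summable fun z : Zd d => μ z * Real.exp (dotZ d a z)) :
    ConvexOn ℝ Set.univ fun a => Real.log (jgf d μ a) := by
  refine ⟨convex_univ, fun a _ b _ s t hs0 ht0 hst => ?_⟩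
  have ha := jgf_pos d hμ hs a
  have hb := jgf_pos d hμ hs b
  have hab := jgf_pos d hμ hs (s • a + t • b)
  simp only [smul_eq_mul]
  set A := Real.log (jgf d μ a) with hA
  set B := Real.log (jgf d μ b) with hB
  have hle : jgf d μ (s • a + t • b) * Real.exp (-(s * A + t * B)) ≤ 1 := by
    have h1 : ∀ z, μ z * Real.exp (dotZ d (s • a + t • b) z) * Real.exp (-(s * A + t * B)) ≤
        s * (μ z * Real.exp (dotZ d a z) * Real.exp (-A)) +
          t * (μ z * Real.exp (dotZ d b z) * Real.exp (-B)) := by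
      intro z
      have h := convexOn_exp.2 (Set.mem_univ (dotZ d a z - A)) (Set.mem_univ (dotZ d b z - B))
        hs0 ht0 hst
      simp only [smul_eq_mul] at h
      calc _ = μ z * Real.exp (s * (dotZ d a z - A) + t * (dotZ d b z - B)) := by
            rw [mul_assoc, ← Real.exp_add, dotZ_combo]
            ring_nf
        _ ≤ μ z * (s * Real.exp (dotZ d a z - A) + t * Real.exp (dotZ d b z - B)) :=
            mul_le_mul_of_nonneg_left h (hμ.1 z)
        _ = _ := by
            simp only [sub_eq_add_neg, Real.exp_add]
            ring
    have h2 := ((((hs a).hasSum.mul_right (Real.exp (-A))).mul_left s).add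
      (((hs b).hasSum.mul_right (Real.exp (-B))).mul_left t))
    have h3 := hasSum_le h1 ((hs (s • a + t • b)).hasSum.mul_right _) h2
    have e1 : jgf d μ a * Real.exp (-A) = 1 := by
      rw [Real.exp_neg, hA, Real.exp_log ha, mul_inv_cancel₀ ha.ne']
    have e2 : jgf d μ b * Real.exp (-B) = 1 := by
      rw [Real.exp_neg, hB, Real.exp_log hb, mul_inv_cancel₀ hb.ne']
    change _ ≤ s * (jgf d μ a * Real.exp (-A)) + t * (jgf d μ b * Real.exp (-B)) at h3
    rw [e1, e2, mul_one, mul_one, hst] at h3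
    exact h3
  rw [Real.exp_neg, ← div_eq_mul_inv, div_le_one (Real.exp_pos _)] at hle
  exact (Real.log_le_iff_le_exp hab).2 hle

theorem stepSn_mul_exp_le (d : ℕ) {μ : Zd d → ℝ} (hμ : IsProb d μ)
    (hs : ∀ a : Rd d, Summable fun z : Zd d => μ z * Real.exp (dotZ d a z)) (a : Rd d) (n : ℕ)
    (z w : Zd d) :
    stepSn d μ n z w * ENNReal.ofReal (Real.exp (dotZ d a (w - z))) ≤
      ENNReal.ofReal (jgf d μ a) ^ n := by
  have htot : ∀ w : Zd d, ∑' u : Zd d,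
      ENNReal.ofReal (μ (w - u)) * ENNReal.ofReal (Real.exp (dotZ d a (w - u))) =
        ENNReal.ofReal (jgf d μ a) := by
    intro w
    refine ((Equiv.subLeft w).tsum_eq
      (fun x => ENNReal.ofReal (μ x) * ENNReal.ofReal (Real.exp (dotZ d a x)))).trans ?_
    simp only [← ENNReal.ofReal_mul (hμ.1 _)]
    exact (ENNReal.ofReal_tsum_of_nonneg
      (fun x => mul_nonneg (hμ.1 x) (Real.exp_pos _).le) (hs a)).symm
  induction n generalizing w with
  | zero =>
    by_cases h : z = w
    · subst h
      simp [stepSn, kerIter, dotZ]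
    · simp [stepSn, kerIter, h]
  | succ n ih =>
    change (∑' u, stepSn d μ n z u * stepS d μ u w) * _ ≤ _
    have hpow := pow_succ (ENNReal.ofReal (jgf d μ a)) n
    nth_rewrite 3 [← htot w] at hpow
    rw [hpow, ← ENNReal.tsum_mul_right, ← ENNReal.tsum_mul_left]
    refine ENNReal.tsum_le_tsum fun u => ?_
    have hsplit : ENNReal.ofReal (Real.exp (dotZ d a (w - z))) =
        ENNReal.ofReal (Real.exp (dotZ d a (u - z))) *
          ENNReal.ofReal (Real.exp (dotZ d a (w - u))) := by
      rw [← ENNReal.ofReal_mul (Real.exp_pos _).le, ← Real.exp_add, ← dotZ_add_right]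
      congr 3
      abel
    rw [hsplit, stepS]
    calc _ = (stepSn d μ n z u * ENNReal.ofReal (Real.exp (dotZ d a (u - z)))) *
          (ENNReal.ofReal (μ (w - u)) * ENNReal.ofReal (Real.exp (dotZ d a (w - u)))) := by ring
      _ ≤ _ := mul_le_mul_left (ih u) _

theorem exists_dotZ_le (d : ℕ) {μ : Zd d → ℝ} (hμ : IsProb d μ)
    (hs : ∀ a : Rd d, Summable fun z : Zd d => μ z * Real.exp (dotZ d a z))
    (hirr : ∀ z z' : Zd d, ∃ n : ℕ, 0 < stepSn d μ n z z') {z : Zd d} (hz : z ≠ 0) :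
    ∃ n : ℕ, 0 < n ∧ ∃ C : ℝ, ∀ a : Rd d, dotZ d a z ≤ n * Real.log (jgf d μ a) + C := by
  obtain ⟨n, hn⟩ := hirr 0 z
  have hn0 : 0 < n := by
    rcases Nat.eq_zero_or_pos n with rfl | h
    · simp [stepSn, kerIter, hz.symm] at hn
    · exact h
  have hle : ∀ a, stepSn d μ n 0 z * ENNReal.ofReal (Real.exp (dotZ d a z)) ≤
      ENNReal.ofReal (jgf d μ a ^ n) := fun a => by
    simpa [ENNReal.ofReal_pow (jgf_pos d hμ hs a).le] using stepSn_mul_exp_le d hμ hs a n 0 z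
  have hfin : stepSn d μ n 0 z ≠ ⊤ := by
    intro h
    have := hle 0
    rw [h, ENNReal.top_mul (by simpa using Real.exp_pos _)] at this
    exact ENNReal.ofReal_ne_top (top_le_iff.1 this)
  have hp : 0 < (stepSn d μ n 0 z).toReal := ENNReal.toReal_pos hn.ne' hfin
  refine ⟨n, hn0, -Real.log (stepSn d μ n 0 z).toReal, fun a => ?_⟩
  have hj := jgf_pos d hμ hs a
  have h := hle a
  rw [← ENNReal.ofReal_toReal hfin, ← ENNReal.ofReal_mul hp.le,
    ENNReal.ofReal_le_ofReal_iff (by positivity)] at h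
  have h2 := Real.log_le_log (by positivity) h
  rw [Real.log_mul hp.ne' (Real.exp_pos _).ne', Real.log_exp, Real.log_pow] at h2
  linarith

theorem exists_neg_le_log_jgf (d : ℕ) {μ : Zd d → ℝ} (hμ : IsProb d μ)
    (hs : ∀ a : Rd d, Summable fun z : Zd d => μ z * Real.exp (dotZ d a z))
    (hirr : ∀ z z' : Zd d, ∃ n : ℕ, 0 < stepSn d μ n z z') :
    ∃ M : ℝ, ∀ a : Rd d, -M ≤ Real.log (jgf d μ a) := by
  have hz : ((0, 1) : Zd d) ≠ 0 := by simp [Prod.ext_iff]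
  obtain ⟨n, hn, C, hC⟩ := exists_dotZ_le d hμ hs hirr hz
  obtain ⟨m, -, C', hC'⟩ := exists_dotZ_le d hμ hs hirr (neg_ne_zero.2 hz)
  have hpos : (0 : ℝ) < n + m := by positivity
  refine ⟨(C + C') / (n + m), fun a => ?_⟩
  have h1 := hC a
  have h2 := hC' a
  rw [dotZ_neg_right] at h2
  rw [neg_le, ← sub_nonneg, sub_neg_eq_add, ← mul_nonneg_iff_of_pos_left hpos, mul_add,
    mul_div_cancel₀ _ hpos.ne']
  linarith

theorem isBounded_log_jgf_le (d : ℕ) {μ : Zd d → ℝ} (hμ : IsProb d μ)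
    (hs : ∀ a : Rd d, Summable fun z : Zd d => μ z * Real.exp (dotZ d a z))
    (hirr : ∀ z z' : Zd d, ∃ n : ℕ, 0 < stepSn d μ n z z') (r : ℝ) :
    Bornology.IsBounded {a : Rd d | Real.log (jgf d μ a) ≤ r} := by
  have hdir : ∀ z : Zd d, z ≠ 0 → ∃ C : ℝ, ∀ a : Rd d, Real.log (jgf d μ a) ≤ r →
      |dotZ d a z| ≤ C := by
    intro z hz
    obtain ⟨n, -, C, hC⟩ := exists_dotZ_le d hμ hs hirr hz
    obtain ⟨m, -, C', hC'⟩ := exists_dotZ_le d hμ hs hirr (neg_ne_zero.2 hz)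
    refine ⟨max (n * r + C) (m * r + C'), fun a ha => abs_le'.2 ⟨?_, ?_⟩⟩
    · refine ((hC a).trans ?_).trans (le_max_left _ _)
      gcongr
    · rw [← dotZ_neg_right]
      refine ((hC' a).trans ?_).trans (le_max_right _ _)
      gcongr
  obtain ⟨C₂, hC₂⟩ := hdir (0, 1) (by simp [Prod.ext_iff])
  choose C₁ hC₁ using fun i : Fin (d - 1) => hdir (Pi.single i 1, 0) (by simp [Prod.ext_iff])
  refine (Metric.isBounded_iff_subset_closedBall 0).2 ⟨max (∑ i, |C₁ i|) C₂, fun a ha => ?_⟩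
  rw [mem_closedBall_zero_iff, Prod.norm_def]
  refine max_le_max ?_ ?_
  · refine (pi_norm_le_iff_of_nonneg (Finset.sum_nonneg fun i _ => abs_nonneg _)).2 fun i => ?_
    have h := hC₁ i a ha
    have he : dotZ d a (Pi.single i 1, 0) = a.1 i := by
      simp [dotZ, Pi.single_apply]
    rw [he] at h
    exact (h.trans (le_abs_self _)).trans
      (Finset.single_le_sum (f := fun i => |C₁ i|) (fun j _ => abs_nonneg _) (Finset.mem_univ i))
  · simpa [dotZ] using hC₂ a ha

theorem iInf_mul_logConj_eq (d : ℕ) {μ : Zd d → ℝ} (hμ : IsProb d μ)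
    (hirr : ∀ z z' : Zd d, ∃ n : ℕ, 0 < stepSn d μ n z z')
    (hs : ∀ a : Rd d, Summable fun z : Zd d => μ z * Real.exp (dotZ d a z)) (v : Rd d) :
    (⨅ T : Set.Ioi (0 : ℝ), ((T : ℝ) : EReal) * logConj d μ (((T : ℝ))⁻¹ • v))
      = ⨆ a : Dset d μ, ((dotR d (a : Rd d) v : ℝ) : EReal) := by
  apply le_antisymm
  · refine le_of_forall_gt fun x hx => ?_
    obtain ⟨c, hc, hcx⟩ := EReal.lt_iff_exists_real_btwn.1 hx
    obtain ⟨M, hM⟩ := exists_neg_le_log_jgf d hμ hs hirr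
    have hlt : ∀ a, Real.log (jgf d μ a) ≤ 0 → dotRLin d v a < c := by
      intro a ha
      have haD : a ∈ Dset d μ := by
        have := (Real.log_le_iff_le_exp (jgf_pos d hμ hs a)).1 ha
        rwa [Real.exp_zero] at this
      exact EReal.coe_lt_coe_iff.1
        ((le_iSup (fun a : Dset d μ => ((dotR d (a : Rd d) v : ℝ) : EReal)) ⟨a, haD⟩).trans_lt hc)
    obtain ⟨T, hT, hTc⟩ := exists_pos_multiplier (convexOn_log_jgf d hμ hs)
      (x₀ := 0) (by rw [jgf_zero d hμ, Real.log_one])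
      (isBounded_log_jgf_le d hμ hs hirr 1) hM (dotRLin d v) hlt
    refine lt_of_le_of_lt ((iInf_le _ (⟨T, hT⟩ : Set.Ioi (0 : ℝ))).trans ?_) hcx
    have hconj : logConj d μ (T⁻¹ • v) ≤ ((T⁻¹ * c : ℝ) : EReal) := by
      refine iSup_le fun a => EReal.coe_le_coe_iff.2 ?_
      have h : dotR d a v - T * Real.log (jgf d μ a) ≤ c := hTc a
      rw [dotR_smul_right]
      have h' := mul_le_mul_of_nonneg_left h (inv_pos.2 hT).le
      rwa [mul_sub, inv_mul_cancel_left₀ hT.ne'] at h'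
    calc (T : EReal) * logConj d μ (T⁻¹ • v) ≤ (T : EReal) * ((T⁻¹ * c : ℝ) : EReal) :=
          mul_le_mul_of_nonneg_left hconj (EReal.coe_nonneg.2 hT.le)
      _ = c := by rw [← EReal.coe_mul, mul_inv_cancel_left₀ hT.ne']
  · refine iSup_le fun a => le_iInf fun T => ?_
    obtain ⟨T, hT⟩ := T
    obtain ⟨a, ha⟩ := a
    have hT : 0 < T := hT
    have hlog : Real.log (jgf d μ a) ≤ 0 := Real.log_nonpos (jgf_pos d hμ hs a).le ha
    calc ((dotR d a v : ℝ) : EReal)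
        ≤ (T : EReal) * ((dotR d a (T⁻¹ • v) - Real.log (jgf d μ a) : ℝ) : EReal) := by
          rw [← EReal.coe_mul, EReal.coe_le_coe_iff, dotR_smul_right, mul_sub,
            mul_inv_cancel_left₀ hT.ne']
          nlinarith
      _ ≤ (T : EReal) * logConj d μ (T⁻¹ • v) :=
          mul_le_mul_of_nonneg_left
            (le_iSup (fun a : Rd d => ((dotR d a (T⁻¹ • v) - Real.log (jgf d μ a) : ℝ) : EReal)) a)
            (EReal.coe_nonneg.2 hT.le)

/-- `inf_{T>0} T (log φ)*(v/T) = sup_{a∈D} a·v` for every `v ∈ ℝ^d`;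
in particular the quasi-potential `I⁺(q',q) = inf_{T>0} T (log φ)*((q-q')/T)`
equals `sup_{a∈D} a·(q-q')` for `q',q ∈ ℝ^{d-1}×[0,∞)`. -/
theorem quasipotential_killed_walk
    (d : ℕ) (hd : 2 ≤ d) (μ : Zd d → ℝ)
    (hμ : IsProb d μ) (hH2 : H2 d μ)
    (hH4 : ∀ a : Rd d, Summable fun z : Zd d => μ z * Real.exp (dotZ d a z)) :
    (∀ v : Rd d,
      (⨅ T : Set.Ioi (0 : ℝ), ((T : ℝ) : EReal) * logConj d μ (((T : ℝ))⁻¹ • v))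
        = ⨆ a : Dset d μ, ((dotR d (a : Rd d) v : ℝ) : EReal)) ∧
    (∀ q' q : Rd d, 0 ≤ q'.2 → 0 ≤ q.2 →
      (⨅ T : Set.Ioi (0 : ℝ),
          ((T : ℝ) : EReal) * logConj d μ (((T : ℝ))⁻¹ • (q - q')))
        = ⨆ a : Dset d μ, ((dotR d (a : Rd d) (q - q') : ℝ) : EReal)) := by
  exact ⟨iInf_mul_logConj_eq d hμ hH2.1 hH4,
    fun q' q _ _ => iInf_mul_logConj_eq d hμ hH2.1 hH4 (q - q')⟩

end ReflectedRW
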